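/- arXiv:2411.08167 — 12 statements merged into one kernel-verified Lean document; each statement's English description precedes it below -/
import Mathlib

section
/- Suppose the good event 𝓔_m holds at epoch m (i.e., for every arm k, |r_k^m − μ_k| ≤ 2C^m/T^m + Δ_k^{m−1}/16, where the gaps Δ_k^{m−1} from the previous epoch are the recursively defined nonnegative quantities). Then −2C^m/T^m − Δ_{k*}^{m−1}/8 ≤ r_*^m − μ* ≤ 2C^m/T^m. -/
/-- Single-agent BARBAR analysis, Lemma 5: under the good event at epoch `m`,
`-2C^m/T^m - Δ_{k*}^{m-1}/8 ≤ r_*^m - μ* ≤ 2C^m/T^m`. -/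
theorem stmt_0
    {ι : Type*} [Fintype ι] [Nonempty ι]
    (μ : ι → ℝ) (hμ0 : ∀ k, 0 ≤ μ k) (hμ1 : ∀ k, μ k ≤ 1)
    (kstar : ι) (hkstar : ∀ k, μ k ≤ μ kstar)
    (T C : ℕ → ℝ) (r : ι → ℕ → ℝ)
    (Δh : ι → ℕ → ℝ) (rstar : ℕ → ℝ)
    (hΔ0 : ∀ k, Δh k 0 = 1)
    (hrstar : ∀ m, 1 ≤ m →
      rstar m = Finset.univ.sup' Finset.univ_nonempty
        (fun k => r k m - Δh k (m - 1) / 16))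
    (hΔrec : ∀ m, 1 ≤ m → ∀ k,
      Δh k m = max ((2:ℝ) ^ (-(m:ℤ))) (rstar m - r k m))
    (m : ℕ) (hm : 1 ≤ m) (hT : 0 < T m) (hC : 0 ≤ C m)
    (hE : ∀ k, |r k m - μ k| ≤ 2 * C m / T m + Δh k (m - 1) / 16) :
    -(2 * C m / T m) - Δh kstar (m - 1) / 8 ≤ rstar m - μ kstar ∧
      rstar m - μ kstar ≤ 2 * C m / T m := by
  rw [hrstar m hm]
  constructor
  · have hle := Finset.le_sup' (fun k => r k m - Δh k (m - 1) / 16) (Finset.mem_univ kstar)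
    have hlow := (abs_le.mp (hE kstar)).1
    linarith
  · rw [sub_le_iff_le_add]
    refine Finset.sup'_le _ _ fun k _ => ?_
    linarith [(abs_le.mp (hE k)).2, hkstar k]
end

section
/- Suppose the good event 𝓔_s holds for every epoch s = 1,…,m (i.e., for every arm k and every s ≤ m, |r_k^s − μ_k| ≤ 2C^s/T^s + Δ_k^{s−1}/16). Then for every arm k, the empirical gap satisfies Δ_k^m ≤ 2(Δ_k + 2^{−m} + ρ^m). -/
/-- Dividing the corruption weights by `8` at each epoch gives a one-step recursion. -/
theorem sum_corruption_succ (C T : ℕ → ℝ) (n : ℕ) :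
    ∑ s ∈ Finset.Icc 1 (n + 1), 2 * C s / ((8:ℝ) ^ (n + 1 - s) * T s) =
      (∑ s ∈ Finset.Icc 1 n, 2 * C s / ((8:ℝ) ^ (n - s) * T s)) / 8 +
        2 * C (n + 1) / T (n + 1) := by
  rw [Finset.sum_Icc_succ_top (by omega), Finset.sum_div]
  congr 1
  · refine Finset.sum_congr rfl fun s hs => ?_
    rw [Nat.succ_sub (Finset.mem_Icc.mp hs).2, pow_succ, div_div]
    congr 1
    ring
  · simp

/-- Single-agent BARBAR analysis, Lemma 6: if the good event holds at every
epoch `s = 1,…,m`, then for every arm `k`, `Δ_k^m ≤ 2(Δ_k + 2^{-m} + ρ^m)`. -/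
theorem stmt_1
    {ι : Type*} [Fintype ι] [Nonempty ι]
    (μ : ι → ℝ) (hμ0 : ∀ k, 0 ≤ μ k) (hμ1 : ∀ k, μ k ≤ 1)
    (kstar : ι) (hkstar : ∀ k, μ k ≤ μ kstar)
    (T C : ℕ → ℝ) (r : ι → ℕ → ℝ)
    (Δh : ι → ℕ → ℝ) (rstar : ℕ → ℝ)
    (hΔ0 : ∀ k, Δh k 0 = 1)
    (hrstar : ∀ m, 1 ≤ m →
      rstar m = Finset.univ.sup' Finset.univ_nonempty
        (fun k => r k m - Δh k (m - 1) / 16))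
    (hΔrec : ∀ m, 1 ≤ m → ∀ k,
      Δh k m = max ((2:ℝ) ^ (-(m:ℤ))) (rstar m - r k m))
    (ρ : ℕ → ℝ)
    (hρ : ∀ n, ρ n = ∑ s ∈ Finset.Icc 1 n, 2 * C s / ((8:ℝ) ^ (n - s) * T s))
    (m : ℕ) (hm : 1 ≤ m)
    (hT : ∀ s, 1 ≤ s → s ≤ m → 0 < T s)
    (hC : ∀ s, 1 ≤ s → s ≤ m → 0 ≤ C s)
    (hE : ∀ s, 1 ≤ s → s ≤ m → ∀ k,
      |r k s - μ k| ≤ 2 * C s / T s + Δh k (s - 1) / 16) :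
    ∀ k, Δh k m ≤ 2 * ((μ kstar - μ k) + (2:ℝ) ^ (-(m:ℤ)) + ρ m) := by
  have key : ∀ n ≤ m, 0 ≤ ρ n ∧
      ∀ k, Δh k n ≤ 2 * ((μ kstar - μ k) + (2:ℝ) ^ (-(n:ℤ)) + ρ n) := by
    intro n
    induction n with
    | zero =>
      intro _
      have h0 : ρ 0 = 0 := by simp [hρ]
      refine ⟨h0.ge, fun k => ?_⟩
      have := hkstar k
      simp only [hΔ0, h0, Nat.cast_zero, neg_zero, zpow_zero]
      linarith
    | succ n ih =>
      intro hn
      obtain ⟨hρn, hgap⟩ := ih (by omega)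
      have hs : 1 ≤ n + 1 := by omega
      have hρs : ρ (n + 1) = ρ n / 8 + 2 * C (n + 1) / T (n + 1) := by
        rw [hρ, hρ, sum_corruption_succ]
      have hCT : 0 ≤ 2 * C (n + 1) / T (n + 1) :=
        div_nonneg (mul_nonneg zero_le_two (hC _ hs hn)) (hT _ hs hn).le
      have hpow : (2:ℝ) ^ (-(n:ℤ)) = 2 * (2:ℝ) ^ (-((n + 1 : ℕ):ℤ)) := by
        rw [← zpow_one_add₀ two_ne_zero]
        congr 1
        push_cast
        ring
      have hpos : (0:ℝ) < (2:ℝ) ^ (-((n + 1 : ℕ):ℤ)) := by positivity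
      have hstar : rstar (n + 1) ≤ μ kstar + 2 * C (n + 1) / T (n + 1) := by
        rw [hrstar _ hs]
        refine Finset.sup'_le _ _ fun j _ => ?_
        have := (abs_le.mp (hE _ hs hn j)).2
        have := hkstar j
        linarith
      refine ⟨by rw [hρs]; positivity, fun k => ?_⟩
      have hk := hkstar k
      have hdev := (abs_le.mp (hE _ hs hn k)).1
      have hprev := hgap k
      rw [Nat.add_sub_cancel] at hdev
      rw [hpow] at hprev
      rw [hΔrec _ hs, hρs]
      apply max_le <;> linarith
  exact (key m le_rfl).2
end

section
/- Suppose the good event 𝓔_m holds at epoch m (i.e., for every arm k, |r_k^m − μ_k| ≤ 2C^m/(L·T^m) + Δ_k^{m−1}/16). Then −2C^m/(L·T^m) − Δ_{k*}^{m−1}/8 ≤ r_*^m − μ* ≤ 2C^m/(L·T^m). -/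
/-- Homogeneous multi-agent analysis, Lemma 5: under the good event at epoch `m`,
`-2C^m/(L·T^m) - Δ_{k*}^{m-1}/8 ≤ r_*^m - μ* ≤ 2C^m/(L·T^m)`. -/
theorem stmt_5
    {ι : Type*} [Fintype ι] [Nonempty ι]
    (L : ℕ) (hL : 1 ≤ L)
    (μ : ι → ℝ) (hμ0 : ∀ k, 0 ≤ μ k) (hμ1 : ∀ k, μ k ≤ 1)
    (kstar : ι) (hkstar : ∀ k, μ k ≤ μ kstar)
    (T C : ℕ → ℝ) (r : ι → ℕ → ℝ)
    (Δh : ι → ℕ → ℝ) (rstar : ℕ → ℝ)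
    (hΔ0 : ∀ k, Δh k 0 = 1)
    (hrstar : ∀ m, 1 ≤ m →
      rstar m = Finset.univ.sup' Finset.univ_nonempty
        (fun k => r k m - Δh k (m - 1) / 16))
    (hΔrec : ∀ m, 1 ≤ m → ∀ k,
      Δh k m = max ((2:ℝ) ^ (-(m:ℤ))) (rstar m - r k m))
    (m : ℕ) (hm : 1 ≤ m) (hT : 0 < T m) (hC : 0 ≤ C m)
    (hE : ∀ k, |r k m - μ k| ≤ 2 * C m / (L * T m) + Δh k (m - 1) / 16) :
    -(2 * C m / (L * T m)) - Δh kstar (m - 1) / 8 ≤ rstar m - μ kstar ∧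
      rstar m - μ kstar ≤ 2 * C m / (L * T m) := by
  rw [hrstar m hm]
  constructor
  · have hsup := Finset.le_sup' (fun k => r k m - Δh k (m - 1) / 16) (Finset.mem_univ kstar)
    have hlower := (abs_le.mp (hE kstar)).1
    linarith
  · rw [sub_le_iff_le_add]
    refine Finset.sup'_le _ _ fun k _ => ?_
    have hupper := (abs_le.mp (hE k)).2
    linarith [hkstar k]
end

section
/- Suppose the good event 𝓔_s holds for every epoch s = 1,…,m (i.e., for every arm k and every s ≤ m, |r_k^s − μ_k| ≤ 2C^s/(L·T^s) + Δ_k^{s−1}/16). Then for every arm k, r_*^m − r_k^m ≤ 2(Δ_k + 2^{−m} + ρ^m), and consequently Δ_k^m ≤ 2(Δ_k + 2^{−m} + ρ^m). -/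
/-- Homogeneous multi-agent analysis, Lemma 6: if the good event holds at every
epoch `s = 1,…,m`, then for every arm `k`,
`r_*^m - r_k^m ≤ 2(Δ_k + 2^{-m} + ρ^m)` and `Δ_k^m ≤ 2(Δ_k + 2^{-m} + ρ^m)`. -/
theorem stmt_6
    {ι : Type*} [Fintype ι] [Nonempty ι]
    (L : ℕ) (hL : 1 ≤ L)
    (μ : ι → ℝ) (hμ0 : ∀ k, 0 ≤ μ k) (hμ1 : ∀ k, μ k ≤ 1)
    (kstar : ι) (hkstar : ∀ k, μ k ≤ μ kstar)
    (T C : ℕ → ℝ) (r : ι → ℕ → ℝ)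
    (Δh : ι → ℕ → ℝ) (rstar : ℕ → ℝ)
    (hΔ0 : ∀ k, Δh k 0 = 1)
    (hrstar : ∀ m, 1 ≤ m →
      rstar m = Finset.univ.sup' Finset.univ_nonempty
        (fun k => r k m - Δh k (m - 1) / 16))
    (hΔrec : ∀ m, 1 ≤ m → ∀ k,
      Δh k m = max ((2:ℝ) ^ (-(m:ℤ))) (rstar m - r k m))
    (ρ : ℕ → ℝ)
    (hρ : ∀ n, ρ n = ∑ s ∈ Finset.Icc 1 n,
      2 * C s / ((8:ℝ) ^ (n - s) * (L * T s)))
    (m : ℕ) (hm : 1 ≤ m)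
    (hT : ∀ s, 1 ≤ s → s ≤ m → 0 < T s)
    (hC : ∀ s, 1 ≤ s → s ≤ m → 0 ≤ C s)
    (hE : ∀ s, 1 ≤ s → s ≤ m → ∀ k,
      |r k s - μ k| ≤ 2 * C s / (L * T s) + Δh k (s - 1) / 16) :
    ∀ k, rstar m - r k m ≤ 2 * ((μ kstar - μ k) + (2:ℝ) ^ (-(m:ℤ)) + ρ m) ∧
      Δh k m ≤ 2 * ((μ kstar - μ k) + (2:ℝ) ^ (-(m:ℤ)) + ρ m) := by
  have hLpos : (0:ℝ) < L := by exact_mod_cast hL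
  have hc : ∀ s, 1 ≤ s → s ≤ m → 0 ≤ 2 * C s / (L * T s) := fun s h1 h2 =>
    div_nonneg (mul_nonneg zero_le_two (hC s h1 h2)) (mul_pos hLpos (hT s h1 h2)).le
  have hρ_zero : ρ 0 = 0 := by simp [hρ]
  have hρ_succ : ∀ n, ρ (n + 1) = ρ n / 8 + 2 * C (n + 1) / (L * T (n + 1)) := by
    intro n
    rw [hρ, hρ, Finset.sum_Icc_succ_top (by omega), Finset.sum_div]
    congr 1
    · refine Finset.sum_congr rfl fun s hs => ?_
      have hsn : n + 1 - s = (n - s) + 1 := by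
        have := (Finset.mem_Icc.mp hs).2
        omega
      rw [hsn, pow_succ, div_div]
      congr 1
      ring
    · simp
  have hρ_nonneg : ∀ n, n ≤ m → 0 ≤ ρ n := by
    intro n
    induction n with
    | zero => intro _; exact hρ_zero.ge
    | succ n ih =>
      intro hn
      rw [hρ_succ]
      linarith [ih (by omega), hc (n + 1) (by omega) hn]
  have two_zpow_succ : ∀ n : ℕ,
      (2:ℝ) ^ (-((n + 1 : ℕ) : ℤ)) = (2:ℝ) ^ (-(n : ℤ)) / 2 := by
    intro n
    simp only [zpow_neg, zpow_natCast, pow_succ, mul_inv]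
    ring
  have hstep : ∀ k n, n + 1 ≤ m →
      Δh k n ≤ 2 * ((μ kstar - μ k) + (2:ℝ) ^ (-(n:ℤ)) + ρ n) →
      rstar (n + 1) - r k (n + 1) ≤
        2 * ((μ kstar - μ k) + (2:ℝ) ^ (-((n + 1 : ℕ):ℤ)) + ρ (n + 1)) := by
    intro k n hn hΔ
    have hupper : rstar (n + 1) ≤ μ kstar + 2 * C (n + 1) / (L * T (n + 1)) := by
      rw [hrstar (n + 1) (by omega)]
      refine Finset.sup'_le _ _ fun j _ => ?_
      linarith [(abs_le.mp (hE (n + 1) (by omega) hn j)).2, hkstar j]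
    have hlower := (abs_le.mp (hE (n + 1) (by omega) hn k)).1
    rw [Nat.add_sub_cancel] at hlower
    rw [two_zpow_succ, hρ_succ]
    have hpos : (0:ℝ) < (2:ℝ) ^ (-(n:ℤ)) := by positivity
    linarith [hρ_nonneg n (by omega), hkstar k]
  have hbound : ∀ k n, n ≤ m →
      Δh k n ≤ 2 * ((μ kstar - μ k) + (2:ℝ) ^ (-(n:ℤ)) + ρ n) := by
    intro k n
    induction n with
    | zero =>
      intro _
      rw [hΔ0, hρ_zero]
      norm_num
      linarith [hkstar k]
    | succ n ih =>
      intro hn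
      rw [hΔrec (n + 1) (by omega)]
      refine max_le ?_ (hstep k n hn (ih (by omega)))
      have hpos : (0:ℝ) < (2:ℝ) ^ (-((n + 1 : ℕ):ℤ)) := by positivity
      linarith [hρ_nonneg (n + 1) hn, hkstar k]
  intro k
  refine ⟨?_, hbound k m le_rfl⟩
  exact (le_max_right _ _).trans ((hΔrec m hm k).ge.trans (hbound k m le_rfl))
end

section
/- Suppose the good event 𝓔_s holds for every epoch s = 1,…,m (i.e., for every arm k and every s ≤ m, |r_k^s − μ_k| ≤ 2C^s/(L·T^s) + Δ_k^{s−1}/16). Then for every arm k, r_*^m − r_k^m ≥ (1/2)Δ_k − 3ρ^m − (3/4)·2^{−m}, and consequently Δ_k^m ≥ (1/2)Δ_k − 3ρ^m − (3/4)·2^{−m}. -/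
/-- Homogeneous multi-agent analysis, Lemma 6: if the good event holds at every
epoch `s = 1,…,m`, then for every arm `k`,
`r_*^m - r_k^m ≥ (1/2)Δ_k - 3ρ^m - (3/4)·2^{-m}`, and the same for `Δ_k^m`. -/
theorem stmt_7
    {ι : Type*} [Fintype ι] [Nonempty ι]
    (L : ℕ) (hL : 1 ≤ L)
    (μ : ι → ℝ) (hμ0 : ∀ k, 0 ≤ μ k) (hμ1 : ∀ k, μ k ≤ 1)
    (kstar : ι) (hkstar : ∀ k, μ k ≤ μ kstar)
    (T C : ℕ → ℝ) (r : ι → ℕ → ℝ)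
    (Δh : ι → ℕ → ℝ) (rstar : ℕ → ℝ)
    (hΔ0 : ∀ k, Δh k 0 = 1)
    (hrstar : ∀ m, 1 ≤ m →
      rstar m = Finset.univ.sup' Finset.univ_nonempty
        (fun k => r k m - Δh k (m - 1) / 16))
    (hΔrec : ∀ m, 1 ≤ m → ∀ k,
      Δh k m = max ((2:ℝ) ^ (-(m:ℤ))) (rstar m - r k m))
    (ρ : ℕ → ℝ)
    (hρ : ∀ n, ρ n = ∑ s ∈ Finset.Icc 1 n,
      2 * C s / ((8:ℝ) ^ (n - s) * (L * T s)))
    (m : ℕ) (hm : 1 ≤ m)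
    (hT : ∀ s, 1 ≤ s → s ≤ m → 0 < T s)
    (hC : ∀ s, 1 ≤ s → s ≤ m → 0 ≤ C s)
    (hE : ∀ s, 1 ≤ s → s ≤ m → ∀ k,
      |r k s - μ k| ≤ 2 * C s / (L * T s) + Δh k (s - 1) / 16) :
    ∀ k, (1/2) * (μ kstar - μ k) - 3 * ρ m - (3/4) * (2:ℝ) ^ (-(m:ℤ)) ≤ rstar m - r k m ∧
      (1/2) * (μ kstar - μ k) - 3 * ρ m - (3/4) * (2:ℝ) ^ (-(m:ℤ)) ≤ Δh k m := by
  have hL0 : (0:ℝ) < L := by exact_mod_cast hL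
  have hpow : ∀ n : ℕ, (2:ℝ) ^ (-(n:ℤ)) = 2 * (2:ℝ) ^ (-((n + 1 : ℕ):ℤ)) := by
    intro n
    rw [zpow_neg, zpow_neg, zpow_natCast, zpow_natCast, pow_succ]
    field_simp
  have hρ_zero : ρ 0 = 0 := by simp [hρ]
  have hρ_succ : ∀ n, ρ (n + 1) = 2 * C (n + 1) / (L * T (n + 1)) + ρ n / 8 := by
    intro n
    rw [hρ, hρ, Finset.sum_Icc_succ_top (by omega), Finset.sum_div, add_comm]
    congr 1
    · simp
    · refine Finset.sum_congr rfl fun s hs => ?_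
      rw [Nat.succ_sub (Finset.mem_Icc.mp hs).2, pow_succ, div_div]
      congr 1
      ring
  have hcorr : ∀ s, 1 ≤ s → s ≤ m → 0 ≤ 2 * C s / (L * T s) := fun s h1 h2 =>
    div_nonneg (mul_nonneg two_pos.le (hC s h1 h2)) (mul_pos hL0 (hT s h1 h2)).le
  have hρ_nonneg : ∀ n, n ≤ m → 0 ≤ ρ n := by
    intro n
    induction n with
    | zero => intro _; exact hρ_zero.ge
    | succ n ih =>
      intro hn
      have h1 := ih (by omega)
      have h2 := hcorr (n + 1) (by omega) hn
      rw [hρ_succ]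
      positivity
  have hupper : ∀ n, n ≤ m → ∀ k,
      Δh k n ≤ 2 * (μ kstar - μ k + (2:ℝ) ^ (-(n:ℤ)) + ρ n) := by
    intro n
    induction n with
    | zero =>
      intro _ k
      have h1 := hkstar k
      rw [hΔ0, hρ_zero]
      norm_num
      linarith
    | succ n ih =>
      intro hn k
      have hgap := hkstar k
      have hprev := ih (by omega) k
      have hp := hpow n
      have hpos : (0:ℝ) < (2:ℝ) ^ (-((n + 1 : ℕ):ℤ)) := by positivity
      have hρn := hρ_nonneg n (by omega)
      have hc := hcorr (n + 1) (by omega) hn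
      have hρs := hρ_succ n
      have hEk := abs_le.mp (hE (n + 1) (by omega) hn k)
      have hr : rstar (n + 1) ≤ μ kstar + 2 * C (n + 1) / (L * T (n + 1)) := by
        rw [hrstar (n + 1) (by omega)]
        refine Finset.sup'_le _ _ fun j _ => ?_
        have hEj := abs_le.mp (hE (n + 1) (by omega) hn j)
        linarith [hkstar j]
      rw [Nat.add_sub_cancel] at hEk
      rw [hΔrec (n + 1) (by omega)]
      exact max_le (by linarith) (by linarith)
  intro k
  have hlower : (1/2) * (μ kstar - μ k) - 3 * ρ m - (3/4) * (2:ℝ) ^ (-(m:ℤ))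
      ≤ rstar m - r k m := by
    obtain ⟨n, rfl⟩ := Nat.exists_eq_add_of_le' hm
    have hEk := abs_le.mp (hE (n + 1) hm le_rfl k)
    have hEs := abs_le.mp (hE (n + 1) hm le_rfl kstar)
    have hr : r kstar (n + 1) - Δh kstar (n + 1 - 1) / 16 ≤ rstar (n + 1) := by
      rw [hrstar (n + 1) hm]
      exact Finset.le_sup' (fun j => r j (n + 1) - Δh j (n + 1 - 1) / 16)
        (Finset.mem_univ kstar)
    rw [Nat.add_sub_cancel] at hEk hEs hr
    linarith [hkstar k, hupper n (by omega) k, hupper n (by omega) kstar, hpow n,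
      hρ_nonneg n (by omega), hcorr (n + 1) hm le_rfl, hρ_succ n]
  refine ⟨hlower, hlower.trans ?_⟩
  rw [hΔrec m hm]
  exact le_max_right _ _
end

section
/- Suppose that for every arm k, |r_k^m − μ_k| ≤ 2^{13}·C^m/(L_min·T^m) + Δ_k^{m−1}/16. Then −2^{13}·C^m/(L_min·T^m) − Δ_{k*}^{m−1}/8 ≤ r_{*,max}^m − μ* ≤ 2^{13}·C^m/(L_min·T^m). -/
/-- Heterogeneous multi-agent analysis: under the good event at epoch `m`,
`-2^13·C^m/(L_min·T^m) - Δ_{k*}^{m-1}/8 ≤ r_{*,max}^m - μ* ≤ 2^13·C^m/(L_min·T^m)`. -/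
theorem stmt_8 {ι : Type*} [Fintype ι] [Nonempty ι]
    (μ : ι → ℝ) (hμ0 : ∀ k, 0 ≤ μ k) (hμ1 : ∀ k, μ k ≤ 1)
    (kstar : ι) (hkstar : ∀ k, μ k ≤ μ kstar)
    (Lmin T C : ℝ) (hLmin : 1 ≤ Lmin) (hT : 0 < T) (hC : 0 ≤ C)
    (Δprev : ι → ℝ) (hΔprev : ∀ k, 0 ≤ Δprev k)
    (r : ι → ℝ) (rstarmax : ℝ)
    (hrstar : rstarmax = Finset.univ.sup' Finset.univ_nonempty
      (fun k => r k - Δprev k / 16))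
    (hE : ∀ k, |r k - μ k| ≤ 2 ^ 13 * C / (Lmin * T) + Δprev k / 16) :
    -(2 ^ 13 * C / (Lmin * T)) - Δprev kstar / 8 ≤ rstarmax - μ kstar ∧
      rstarmax - μ kstar ≤ 2 ^ 13 * C / (Lmin * T) := by
  subst hrstar
  constructor
  · have hle := Finset.le_sup' (fun k => r k - Δprev k / 16) (Finset.mem_univ kstar)
    have hlow := (abs_le.mp (hE kstar)).1
    linarith
  · rw [sub_le_iff_le_add]
    refine Finset.sup'_le _ _ fun k _ => ?_
    linarith [(abs_le.mp (hE k)).2, hkstar k]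
end

section
/- Suppose that 2^{−(m−1)} ≤ Δ_{k,ℓ}^{m−1} for every agent ℓ and every arm k ∈ 𝒦_ℓ, and that for every agent ℓ there exists an arm k ∈ 𝒦_ℓ with Δ_{k,ℓ}^{m−1} = 2^{−(m−1)}. Then λ·2^{2(m−1)}/L̂ ≤ N_max^m ≤ K·λ·2^{2(m−1)}, where L̂ = min_{ℓ∈ℒ} max_{k∈𝒦_ℓ} L_k. Moreover, if these hypotheses hold for every epoch m = 1,…,M and Σ_{m=1}^M N_max^m ≤ T for some T > 0, then M ≤ 1 + log_4(L̂·T/λ). -/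
/-- Heterogeneous epoch-length bounds: `λ·4^{m-1}/L̂ ≤ N_max^m ≤ K·λ·4^{m-1}`,
and if `Σ_{m=1}^M N_max^m ≤ T` then `M ≤ 1 + log_4(L̂·T/λ)`. -/
theorem stmt_9 {A ι : Type*} [Fintype A] [Nonempty A] [Fintype ι] [DecidableEq ι]
    (Karm : A → Finset ι) (hK : ∀ ℓ, (Karm ℓ).Nonempty)
    (hcov : ∀ k : ι, ∃ ℓ, k ∈ Karm ℓ)
    (Lk : ι → ℕ)
    (hLk : ∀ k, Lk k = (Finset.univ.filter fun ℓ => k ∈ Karm ℓ).card)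
    (lam : ℝ) (hlam : 0 < lam)
    (M : ℕ) (hM : 1 ≤ M)
    (Δh : ℕ → ι → A → ℝ)
    (hΔpos : ∀ m ℓ, ∀ k ∈ Karm ℓ, 0 < Δh m k ℓ)
    (n : ℕ → ι → A → ℝ)
    (hn : ∀ m ℓ, ∀ k ∈ Karm ℓ, n m k ℓ = lam * (Δh (m - 1) k ℓ)⁻¹ ^ 2 / Lk k)
    (N : ℕ → A → ℝ) (hN : ∀ m ℓ, N m ℓ = ∑ k ∈ Karm ℓ, n m k ℓ)
    (Nmax : ℕ → ℝ)
    (hNmax : ∀ m, Nmax m = Finset.univ.sup' Finset.univ_nonempty (N m))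
    (Lhat : ℝ)
    (hLhat : Lhat = Finset.univ.inf' Finset.univ_nonempty
      (fun ℓ => (Karm ℓ).sup' (hK ℓ) (fun k => (Lk k : ℝ))))
    (hlow : ∀ m ∈ Finset.Icc 1 M, ∀ ℓ, ∀ k ∈ Karm ℓ,
      (2:ℝ) ^ (-((m:ℤ) - 1)) ≤ Δh (m - 1) k ℓ)
    (heq : ∀ m ∈ Finset.Icc 1 M, ∀ ℓ, ∃ k ∈ Karm ℓ,
      Δh (m - 1) k ℓ = (2:ℝ) ^ (-((m:ℤ) - 1))) :
    (∀ m ∈ Finset.Icc 1 M,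
      lam * 2 ^ (2 * (m - 1)) / Lhat ≤ Nmax m ∧
        Nmax m ≤ (Fintype.card ι) * lam * 2 ^ (2 * (m - 1))) ∧
    (∀ T : ℝ, 0 < T → ∑ m ∈ Finset.Icc 1 M, Nmax m ≤ T →
      (M : ℝ) ≤ 1 + Real.logb 4 (Lhat * T / lam)) := by
  have hLk_one : ∀ ℓ, ∀ k ∈ Karm ℓ, (1 : ℝ) ≤ Lk k := by
    intro ℓ k hk
    rw [Nat.one_le_cast, hLk k, Nat.one_le_iff_ne_zero, Finset.card_ne_zero]
    exact ⟨ℓ, by simp [hk]⟩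
  have hLhat_pos : 0 < Lhat := by
    rw [hLhat, Finset.lt_inf'_iff]
    intro ℓ _
    obtain ⟨k, hk⟩ := hK ℓ
    exact zero_lt_one.trans_le
      ((hLk_one ℓ k hk).trans (Finset.le_sup' (fun k => (Lk k : ℝ)) hk))
  have hn_nonneg : ∀ m ℓ, ∀ k ∈ Karm ℓ, 0 ≤ n m k ℓ := by
    intro m ℓ k hk
    rw [hn m ℓ k hk]
    positivity
  have hpow : ∀ m ∈ Finset.Icc 1 M,
      ((2 : ℝ) ^ (-((m : ℤ) - 1)))⁻¹ ^ 2 = 2 ^ (2 * (m - 1)) := by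
    intro m hm
    have hm1 : 1 ≤ m := (Finset.mem_Icc.mp hm).1
    rw [← Nat.cast_pred hm1, zpow_neg, inv_inv, zpow_natCast, ← pow_mul, mul_comm]
  have hlower : ∀ m ∈ Finset.Icc 1 M, lam * 2 ^ (2 * (m - 1)) / Lhat ≤ Nmax m := by
    intro m hm
    obtain ⟨ℓ, -, hℓ⟩ := Finset.exists_mem_eq_inf' (Finset.univ_nonempty (α := A))
      (fun ℓ => (Karm ℓ).sup' (hK ℓ) (fun k => (Lk k : ℝ)))
    obtain ⟨k, hk, hΔ⟩ := heq m hm ℓ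
    have hkL : (Lk k : ℝ) ≤ Lhat := by
      rw [hLhat, hℓ]
      exact Finset.le_sup' (fun k => (Lk k : ℝ)) hk
    have hkpos : (0 : ℝ) < Lk k := zero_lt_one.trans_le (hLk_one ℓ k hk)
    calc lam * 2 ^ (2 * (m - 1)) / Lhat ≤ lam * 2 ^ (2 * (m - 1)) / Lk k := by gcongr
      _ = n m k ℓ := by rw [hn m ℓ k hk, hΔ, hpow m hm]
      _ ≤ N m ℓ := by
        rw [hN]
        exact Finset.single_le_sum (f := fun k => n m k ℓ) (hn_nonneg m ℓ) hk
      _ ≤ Nmax m := by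
        rw [hNmax]
        exact Finset.le_sup' (N m) (Finset.mem_univ ℓ)
  refine ⟨fun m hm => ⟨hlower m hm, ?_⟩, fun T _ hsum => ?_⟩
  · rw [hNmax, Finset.sup'_le_iff]
    intro ℓ _
    have hbound : ∀ k ∈ Karm ℓ, n m k ℓ ≤ lam * 2 ^ (2 * (m - 1)) := by
      intro k hk
      rw [hn m ℓ k hk, ← hpow m hm]
      refine (div_le_self (by positivity) (hLk_one ℓ k hk)).trans ?_
      have := hΔpos (m - 1) ℓ k hk
      have := hlow m hm ℓ k hk
      gcongr
    calc N m ℓ ≤ (Karm ℓ).card • (lam * 2 ^ (2 * (m - 1))) := by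
          rw [hN]
          exact Finset.sum_le_card_nsmul _ _ _ hbound
      _ ≤ (Fintype.card ι) * lam * 2 ^ (2 * (m - 1)) := by
          rw [nsmul_eq_mul, mul_assoc]
          gcongr
          exact Finset.card_le_univ _
  · have hMmem : M ∈ Finset.Icc 1 M := Finset.mem_Icc.mpr ⟨hM, le_rfl⟩
    have hlast : lam * 2 ^ (2 * (M - 1)) / Lhat ≤ T :=
      (hlower M hMmem).trans <| (Finset.single_le_sum (f := Nmax)
        (fun m hm => le_trans (by positivity) (hlower m hm)) hMmem).trans hsum
    have hfour : (4 : ℝ) ^ ((M : ℝ) - 1) ≤ Lhat * T / lam := by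
      rw [← Nat.cast_pred hM, Real.rpow_natCast, le_div_iff₀ hlam]
      rw [div_le_iff₀ hLhat_pos, pow_mul] at hlast
      norm_num at hlast
      linarith
    have := (Real.le_logb_iff_rpow_le (by norm_num)
      (lt_of_lt_of_le (by positivity) hfour)).mpr hfour
    linarith
end

section
/- Suppose the good event 𝓔_m holds at epoch m (i.e., for every arm k, |r_k^m − μ_k| ≤ D^m + Δ_{k,max}^{m−1}/16). Then for every agent ℓ: −D^m − Δ_{k_{*,ℓ},max}^{m−1}/8 ≤ r_{*,ℓ}^m − μ_{*,ℓ} ≤ D^m. -/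
/-- LFBARBAR heterogeneous analysis, Lemma 5: under the good event at epoch `m`,
for every agent `ℓ`,
`-D^m - Δ_{k_{*,ℓ},max}^{m-1}/8 ≤ r_{*,ℓ}^m - μ_{*,ℓ} ≤ D^m`. -/
theorem stmt_10 {A ι : Type*} [Fintype A] [Nonempty A] [Fintype ι] [DecidableEq ι]
    (Karm : A → Finset ι) (hK : ∀ ℓ, (Karm ℓ).Nonempty)
    (hcov : ∀ k : ι, (Finset.univ.filter fun ℓ => k ∈ Karm ℓ).Nonempty)
    (μ : ι → ℝ) (hμ0 : ∀ k, 0 ≤ μ k) (hμ1 : ∀ k, μ k ≤ 1)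
    (kstar : A → ι) (hkmem : ∀ ℓ, kstar ℓ ∈ Karm ℓ)
    (hkmax : ∀ ℓ, ∀ k ∈ Karm ℓ, μ k ≤ μ (kstar ℓ))
    (D : ℕ → ℝ) (hD : ∀ m, 0 ≤ D m)
    (r : ι → ℕ → ℝ)
    (Δh : ι → A → ℕ → ℝ) (Δmax : ι → ℕ → ℝ) (rstar : A → ℕ → ℝ)
    (hΔ0 : ∀ k ℓ, Δh k ℓ 0 = 1)
    (hΔmax : ∀ k m, Δmax k m =
      (Finset.univ.filter fun ℓ => k ∈ Karm ℓ).sup' (hcov k) (fun ℓ => Δh k ℓ m))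
    (hrstar : ∀ ℓ m, 1 ≤ m → rstar ℓ m =
      (Karm ℓ).sup' (hK ℓ) (fun k => r k m - Δmax k (m - 1) / 16))
    (hΔrec : ∀ ℓ m, 1 ≤ m → ∀ k ∈ Karm ℓ,
      Δh k ℓ m = max ((2:ℝ) ^ (-(m:ℤ))) (rstar ℓ m - r k m))
    (m : ℕ) (hm : 1 ≤ m)
    (hE : ∀ k, |r k m - μ k| ≤ D m + Δmax k (m - 1) / 16) :
    ∀ ℓ, -(D m) - Δmax (kstar ℓ) (m - 1) / 8 ≤ rstar ℓ m - μ (kstar ℓ) ∧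
      rstar ℓ m - μ (kstar ℓ) ≤ D m := by
  intro ℓ
  rw [hrstar ℓ m hm]
  constructor
  · have hle := Finset.le_sup' (fun k => r k m - Δmax k (m - 1) / 16) (hkmem ℓ)
    have hlow := (abs_le.mp (hE (kstar ℓ))).1
    linarith
  · rw [sub_le_iff_le_add]
    refine Finset.sup'_le _ _ fun k hk => ?_
    have hup := (abs_le.mp (hE k)).2
    linarith [hkmax ℓ k hk]
end

section
/- Fix an epoch m ≥ 1, an agent ℓ, and an arm k ∈ 𝒦_ℓ. Suppose the good event 𝓔_m holds at epoch m (i.e., for every arm k', |r_{k'}^m − μ_{k'}| ≤ D^m + Δ_{k',max}^{m−1}/16), and suppose the previous-epoch bound Δ_{k,max}^{m−1} ≤ 2(Δ_{k,ℓ} + 2^{−(m−1)} + ρ^{m−1}) holds. Then Δ_{k,ℓ}^m ≤ 2(Δ_{k,ℓ} + 2^{−m} + ρ^m). -/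
/-- Peeling the last term off a geometrically discounted sum. -/
theorem sum_Icc_div_pow_sub_succ (D : ℕ → ℝ) {b : ℝ} (n : ℕ) :
    ∑ s ∈ Finset.Icc 1 (n + 1), D s / b ^ (n + 1 - s) =
      D (n + 1) + (∑ s ∈ Finset.Icc 1 n, D s / b ^ (n - s)) / b := by
  rw [Finset.sum_Icc_succ_top (by lia), Finset.sum_div, Nat.sub_self, pow_zero, div_one,
    add_comm]
  congr 1
  refine Finset.sum_congr rfl fun s hs => ?_
  rw [Nat.succ_sub (Finset.mem_Icc.mp hs).2, pow_succ, div_div]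


/-- LFBARBAR heterogeneous analysis, Lemma 6 (inductive step): under the good
event at epoch `m` and the previous-epoch bound on `Δ_{k,max}^{m-1}`,
`Δ_{k,ℓ}^m ≤ 2(Δ_{k,ℓ} + 2^{-m} + ρ^m)`. -/
theorem stmt_11 {A ι : Type*} [Fintype A] [Nonempty A] [Fintype ι] [DecidableEq ι]
    (Karm : A → Finset ι) (hK : ∀ ℓ, (Karm ℓ).Nonempty)
    (hcov : ∀ k : ι, (Finset.univ.filter fun ℓ => k ∈ Karm ℓ).Nonempty)
    (μ : ι → ℝ) (hμ0 : ∀ k, 0 ≤ μ k) (hμ1 : ∀ k, μ k ≤ 1)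
    (kstar : A → ι) (hkmem : ∀ ℓ, kstar ℓ ∈ Karm ℓ)
    (hkmax : ∀ ℓ, ∀ k ∈ Karm ℓ, μ k ≤ μ (kstar ℓ))
    (D : ℕ → ℝ) (hD : ∀ m, 0 ≤ D m)
    (r : ι → ℕ → ℝ)
    (Δh : ι → A → ℕ → ℝ) (Δmax : ι → ℕ → ℝ) (rstar : A → ℕ → ℝ)
    (hΔ0 : ∀ k ℓ, Δh k ℓ 0 = 1)
    (hΔmax : ∀ k m, Δmax k m =
      (Finset.univ.filter fun ℓ => k ∈ Karm ℓ).sup' (hcov k) (fun ℓ => Δh k ℓ m))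
    (hrstar : ∀ ℓ m, 1 ≤ m → rstar ℓ m =
      (Karm ℓ).sup' (hK ℓ) (fun k => r k m - Δmax k (m - 1) / 16))
    (hΔrec : ∀ ℓ m, 1 ≤ m → ∀ k ∈ Karm ℓ,
      Δh k ℓ m = max ((2:ℝ) ^ (-(m:ℤ))) (rstar ℓ m - r k m))
    (ρ : ℕ → ℝ)
    (hρ : ∀ n, ρ n = ∑ s ∈ Finset.Icc 1 n, D s / (8:ℝ) ^ (n - s))
    (m : ℕ) (hm : 1 ≤ m) (ℓ : A) (k : ι) (hkℓ : k ∈ Karm ℓ)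
    (hE : ∀ k', |r k' m - μ k'| ≤ D m + Δmax k' (m - 1) / 16)
    (hprev : Δmax k (m - 1) ≤
      2 * ((μ (kstar ℓ) - μ k) + (2:ℝ) ^ (-((m:ℤ) - 1)) + ρ (m - 1))) :
    Δh k ℓ m ≤ 2 * ((μ (kstar ℓ) - μ k) + (2:ℝ) ^ (-(m:ℤ)) + ρ m) := by
  obtain ⟨n, rfl⟩ := Nat.exists_eq_add_of_le' hm
  have hρ_succ : ρ (n + 1) = D (n + 1) + ρ n / 8 := by
    rw [hρ, hρ, sum_Icc_div_pow_sub_succ]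
  have hρ_nonneg : 0 ≤ ρ n := by
    rw [hρ]
    exact Finset.sum_nonneg fun s _ => div_nonneg (hD s) (by positivity)
  have hpow : (2 : ℝ) ^ (-(((n + 1 : ℕ) : ℤ) - 1)) = 2 * (2 : ℝ) ^ (-((n + 1 : ℕ) : ℤ)) := by
    rw [neg_sub, sub_eq_add_neg, zpow_add₀ two_ne_zero, zpow_one]
  have hpos : (0 : ℝ) < (2 : ℝ) ^ (-((n + 1 : ℕ) : ℤ)) := by positivity
  have hgap := hkmax ℓ k hkℓ
  have hDm := hD (n + 1)
  have hstar : rstar ℓ (n + 1) ≤ μ (kstar ℓ) + D (n + 1) := by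
    rw [hrstar ℓ _ hm]
    refine Finset.sup'_le _ _ fun j hj => ?_
    have := (abs_le.mp (hE j)).2
    have := hkmax ℓ j hj
    linarith
  have hk := (abs_le.mp (hE k)).1
  rw [hpow] at hprev
  rw [hΔrec ℓ _ hm k hkℓ, hρ_succ]
  simp only [Nat.add_sub_cancel] at hprev hk
  exact max_le (by linarith) (by linarith)
end

section
/- Fix an epoch m ≥ 1, an agent ℓ, and an arm k ∈ 𝒦_ℓ. Suppose the good event 𝓔_m holds at epoch m (i.e., for every arm k', |r_{k'}^m − μ_{k'}| ≤ D^m + Δ_{k',max}^{m−1}/16), and suppose the previous-epoch bounds Δ_{k,max}^{m−1} ≤ 2(Δ_{k,ℓ} + 2^{−(m−1)} + ρ^{m−1}) and Δ_{k_{*,ℓ},max}^{m−1} ≤ 2(2^{−(m−1)} + ρ^{m−1}) hold. Then Δ_{k,ℓ}^m ≥ (1/2)Δ_{k,ℓ} − 3ρ^m − (3/4)·2^{−m}. -/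
/-- The geometrically discounted sum satisfies a one-step recursion. -/
theorem sum_Icc_div_pow_succ (D : ℕ → ℝ) (n : ℕ) :
    ∑ s ∈ Finset.Icc 1 (n + 1), D s / (8:ℝ) ^ (n + 1 - s) =
      D (n + 1) + (∑ s ∈ Finset.Icc 1 n, D s / (8:ℝ) ^ (n - s)) / 8 := by
  rw [Finset.sum_Icc_succ_top (by omega), Finset.sum_div, add_comm]
  congr 1
  · simp
  · refine Finset.sum_congr rfl fun s hs => ?_
    rw [Nat.succ_sub (Finset.mem_Icc.mp hs).2, pow_succ, div_div]

/-- LFBARBAR heterogeneous analysis, Lemma 7 (lower bound): under the good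
event at epoch `m` and the previous-epoch upper bounds on `Δ_{k,max}^{m-1}`
and `Δ_{k_{*,ℓ},max}^{m-1}`,
`Δ_{k,ℓ}^m ≥ (1/2)Δ_{k,ℓ} - 3ρ^m - (3/4)·2^{-m}`. -/
theorem stmt_12 {A ι : Type*} [Fintype A] [Nonempty A] [Fintype ι] [DecidableEq ι]
    (Karm : A → Finset ι) (hK : ∀ ℓ, (Karm ℓ).Nonempty)
    (hcov : ∀ k : ι, (Finset.univ.filter fun ℓ => k ∈ Karm ℓ).Nonempty)
    (μ : ι → ℝ) (hμ0 : ∀ k, 0 ≤ μ k) (hμ1 : ∀ k, μ k ≤ 1)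
    (kstar : A → ι) (hkmem : ∀ ℓ, kstar ℓ ∈ Karm ℓ)
    (hkmax : ∀ ℓ, ∀ k ∈ Karm ℓ, μ k ≤ μ (kstar ℓ))
    (D : ℕ → ℝ) (hD : ∀ m, 0 ≤ D m)
    (r : ι → ℕ → ℝ)
    (Δh : ι → A → ℕ → ℝ) (Δmax : ι → ℕ → ℝ) (rstar : A → ℕ → ℝ)
    (hΔ0 : ∀ k ℓ, Δh k ℓ 0 = 1)
    (hΔmax : ∀ k m, Δmax k m =
      (Finset.univ.filter fun ℓ => k ∈ Karm ℓ).sup' (hcov k) (fun ℓ => Δh k ℓ m))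
    (hrstar : ∀ ℓ m, 1 ≤ m → rstar ℓ m =
      (Karm ℓ).sup' (hK ℓ) (fun k => r k m - Δmax k (m - 1) / 16))
    (hΔrec : ∀ ℓ m, 1 ≤ m → ∀ k ∈ Karm ℓ,
      Δh k ℓ m = max ((2:ℝ) ^ (-(m:ℤ))) (rstar ℓ m - r k m))
    (ρ : ℕ → ℝ)
    (hρ : ∀ n, ρ n = ∑ s ∈ Finset.Icc 1 n, D s / (8:ℝ) ^ (n - s))
    (m : ℕ) (hm : 1 ≤ m) (ℓ : A) (k : ι) (hkℓ : k ∈ Karm ℓ)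
    (hE : ∀ k', |r k' m - μ k'| ≤ D m + Δmax k' (m - 1) / 16)
    (hprev : Δmax k (m - 1) ≤
      2 * ((μ (kstar ℓ) - μ k) + (2:ℝ) ^ (-((m:ℤ) - 1)) + ρ (m - 1)))
    (hprevstar : Δmax (kstar ℓ) (m - 1) ≤
      2 * ((2:ℝ) ^ (-((m:ℤ) - 1)) + ρ (m - 1))) :
    (1/2) * (μ (kstar ℓ) - μ k) - 3 * ρ m - (3/4) * (2:ℝ) ^ (-(m:ℤ)) ≤
      Δh k ℓ m := by
  have hρm : ρ m = D m + ρ (m - 1) / 8 := by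
    obtain ⟨n, rfl⟩ := Nat.exists_eq_add_of_le' hm
    rw [hρ, hρ, sum_Icc_div_pow_succ, Nat.add_sub_cancel]
  have hpow : (2:ℝ) ^ (-((m:ℤ) - 1)) = 2 * (2:ℝ) ^ (-(m:ℤ)) := by
    rw [show -((m:ℤ) - 1) = 1 + -(m:ℤ) by ring, zpow_add₀ two_ne_zero, zpow_one]
  have hstar : r (kstar ℓ) m - Δmax (kstar ℓ) (m - 1) / 16 ≤ rstar ℓ m := by
    rw [hrstar ℓ m hm]
    exact Finset.le_sup' (fun k => r k m - Δmax k (m - 1) / 16) (hkmem ℓ)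
  have hlow : rstar ℓ m - r k m ≤ Δh k ℓ m := by
    rw [hΔrec ℓ m hm k hkℓ]
    exact le_max_right _ _
  have hgap := hkmax ℓ k hkℓ
  have hDm := hD m
  have hk := (abs_le.mp (hE k)).2
  have hks := (abs_le.mp (hE (kstar ℓ))).1
  rw [hpow] at hprev hprevstar
  linarith
end

section
/- Let λ > 0, L ≥ 1, let m ≥ 1 be an integer, let Δ > 0 and ρ ≥ 0 be reals, and let x be a real number satisfying x ≥ 2^{−(m−1)} and x ≥ (1/2)Δ − 3ρ − (3/4)·2^{−(m−1)}. Then Δ·(λ·x^{−2}/L) ≤ 2^{10}·λ/(L·Δ) + 8·(λ/L)·ρ·2^{2m}. -/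
/-- Deterministic three-case per-epoch regret bound: if `x ≥ 2^{-(m-1)}` and
`x ≥ (1/2)Δ - 3ρ - (3/4)·2^{-(m-1)}`, then
`Δ·(λ·x^{-2}/L) ≤ 2^10·λ/(L·Δ) + 8·(λ/L)·ρ·2^{2m}`. -/
theorem stmt_14 (lam L : ℝ) (hlam : 0 < lam) (hL : 1 ≤ L)
    (m : ℕ) (hm : 1 ≤ m) (Δ ρ x : ℝ) (hΔ : 0 < Δ) (hρ : 0 ≤ ρ)
    (hx1 : (2:ℝ) ^ (-((m:ℤ) - 1)) ≤ x)
    (hx2 : (1/2) * Δ - 3 * ρ - (3/4) * (2:ℝ) ^ (-((m:ℤ) - 1)) ≤ x) :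
    Δ * (lam * x⁻¹ ^ 2 / L) ≤
      2 ^ 10 * lam / (L * Δ) + 8 * (lam / L) * ρ * (2:ℝ) ^ (2 * m) := by
  set t : ℝ := (2:ℝ) ^ (-((m:ℤ) - 1)) with ht
  have htpos : 0 < t := by positivity
  have hx : 0 < x := htpos.trans_le hx1
  have hLpos : 0 < L := one_pos.trans_le hL
  have hpow : (2:ℝ) ^ (2 * m) = 4 / t ^ 2 := by
    have h : t = 2 / 2 ^ m := by
      rw [ht, neg_sub, zpow_sub₀ two_ne_zero, zpow_one, zpow_natCast]
    rw [h, mul_comm 2 m, pow_mul]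
    field_simp
    norm_num
  have key : Δ / x ^ 2 ≤ 2 ^ 10 / Δ + 32 * ρ / t ^ 2 := by
    rcases le_or_gt (Δ / 32) ρ with h | h
    · have h1 : Δ / x ^ 2 ≤ 32 * ρ / t ^ 2 := by
        gcongr
        linarith
      have h2 : 0 ≤ 2 ^ 10 / Δ := by positivity
      linarith
    · have h1 : Δ / x ^ 2 ≤ 2 ^ 10 / Δ := by
        have hΔx : Δ ≤ 32 * x := by linarith
        rw [div_le_div_iff₀ (by positivity) hΔ]
        nlinarith
      have h2 : 0 ≤ 32 * ρ / t ^ 2 := by positivity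
      linarith
  calc Δ * (lam * x⁻¹ ^ 2 / L) = lam / L * (Δ / x ^ 2) := by
        field_simp
    _ ≤ lam / L * (2 ^ 10 / Δ + 32 * ρ / t ^ 2) := by gcongr
    _ = 2 ^ 10 * lam / (L * Δ) + 8 * (lam / L) * ρ * (2:ℝ) ^ (2 * m) := by
        rw [hpow]
        field_simp
        ring
end

section
/- Suppose that for every epoch m = 1,…,M, every agent ℓ, and every arm k ∈ 𝒦_ℓ, the previous-epoch empirical gaps satisfy Δ_{k,ℓ}^{m−1} ≥ 2^{−(m−1)} and Δ_{k,ℓ}^{m−1} ≥ (1/2)Δ_{k,ℓ} − 3ρ^{m−1} − (3/4)·2^{−(m−1)}, and suppose D^s ≤ 2·L̂·c^s/(λ·4^{s−1}) for every 1 ≤ s ≤ M−1, where c^s ≥ 0. Then the total approximate regret satisfies Σ_{m=1}^M Σ_{ℓ∈ℒ} Σ_{k∈𝒦_ℓ} Δ_{k,ℓ}·n_{k,ℓ}^m ≤ 2^{10}·λ·M·Σ_{ℓ∈ℒ} Σ_{k∈𝒦_ℓ, Δ_{k,ℓ}>0} 1/(L_k·Δ_{k,ℓ}) + 2^{9}·L̂·(Σ_{ℓ∈ℒ}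 Σ_{k∈𝒦_ℓ} 1/L_k)·Σ_{s=1}^{M−1} c^s. -/
/-- Convolving with `8⁻ʲ` and weighting by `4ʲ` at most doubles the `4ʲ`-weighted sum; the slack is
exactly the last term. -/
theorem sum_four_pow_mul_discounted (D ρ : ℕ → ℝ)
    (hρ : ∀ j, ρ j = ∑ s ∈ Finset.Icc 1 j, D s / (8:ℝ) ^ (j - s)) (N : ℕ) :
    ∑ j ∈ Finset.range (N + 1), 4 ^ j * ρ j + 4 ^ N * ρ N =
      2 * ∑ s ∈ Finset.Icc 1 N, 4 ^ s * D s := by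
  have hrec (j : ℕ) : ρ (j + 1) = ρ j / 8 + D (j + 1) := by
    rw [hρ (j + 1), hρ j, Finset.sum_Icc_succ_top (by omega), Finset.sum_div]
    congr 1
    · refine Finset.sum_congr rfl fun s hs => ?_
      rw [Nat.succ_sub (Finset.mem_Icc.1 hs).2, pow_succ, div_div]
    · simp
  induction N with
  | zero => simp [hρ 0]
  | succ N ih =>
    rw [Finset.sum_range_succ, Finset.sum_Icc_succ_top (by omega), mul_add, ← ih, hrec]
    ring

/-- A gap divided by the square of an estimate bounded below by `e` and, up to an error `3 * r`, by
a multiple of the gap. -/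
theorem gap_mul_inv_sq_le {d h e r : ℝ} (hd : 0 < d) (he : 0 < e) (hr : 0 ≤ r)
    (heh : e ≤ h) (hdh : 1 / 2 * d - 3 * r - 3 / 4 * e ≤ h) :
    d * h⁻¹ ^ 2 ≤ 49 / d + 12 * (r * (e⁻¹) ^ 2) := by
  have hh : 0 < h := he.trans_le heh
  rcases le_total (12 * r) d with hrd | hrd
  · have hinv : h⁻¹ ≤ 7 / d := by
      rw [inv_le_comm₀ hh (by positivity), inv_div]
      linarith
    calc d * h⁻¹ ^ 2 ≤ d * (7 / d) ^ 2 := by gcongr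
      _ = 49 / d := by field_simp; norm_num
      _ ≤ _ := le_add_of_nonneg_right (by positivity)
  · calc d * h⁻¹ ^ 2 ≤ 12 * r * e⁻¹ ^ 2 := by gcongr
      _ = 12 * (r * e⁻¹ ^ 2) := by ring
      _ ≤ _ := le_add_of_nonneg_left (by positivity)

/-- The corruption part of the regret is controlled by the total corruption. -/
theorem sum_four_pow_mul_discounted_le {lam Lhat : ℝ} (hlam : 0 < lam) (M : ℕ) (D c ρ : ℕ → ℝ)
    (hD0 : ∀ s, 0 ≤ D s)
    (hD : ∀ s ∈ Finset.Icc 1 (M - 1), D s ≤ 2 * Lhat * c s / (lam * 4 ^ (s - 1)))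
    (hρ : ∀ j, ρ j = ∑ s ∈ Finset.Icc 1 j, D s / (8:ℝ) ^ (j - s)) :
    lam * ∑ m ∈ Finset.Icc 1 M, 4 ^ (m - 1) * ρ (m - 1) ≤
      16 * Lhat * ∑ s ∈ Finset.Icc 1 (M - 1), c s := by
  cases M with
  | zero => simp
  | succ N =>
    rw [Nat.add_sub_cancel] at hD ⊢
    have hshift : ∑ m ∈ Finset.Icc 1 (N + 1), 4 ^ (m - 1) * ρ (m - 1) =
        ∑ j ∈ Finset.range (N + 1), 4 ^ j * ρ j := by
      rw [← Finset.Ico_succ_right_eq_Icc, Finset.sum_Ico_eq_sum_range]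
      simp
    have hρN : 0 ≤ ρ N := by
      rw [hρ]
      exact Finset.sum_nonneg fun s _ => div_nonneg (hD0 s) (by positivity)
    have hsum := sum_four_pow_mul_discounted D ρ hρ N
    have hle : ∑ j ∈ Finset.range (N + 1), 4 ^ j * ρ j ≤
        2 * ∑ s ∈ Finset.Icc 1 N, 4 ^ s * D s := by
      have : 0 ≤ 4 ^ N * ρ N := by positivity
      linarith
    rw [hshift]
    calc _ ≤ lam * (2 * ∑ s ∈ Finset.Icc 1 N, 4 ^ s * D s) := by gcongr
      _ = ∑ s ∈ Finset.Icc 1 N, lam * (2 * (4 ^ s * D s)) := by simp only [Finset.mul_sum]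
      _ ≤ ∑ s ∈ Finset.Icc 1 N, 16 * Lhat * c s := by
        refine Finset.sum_le_sum fun s hs => ?_
        have h := hD s hs
        obtain ⟨t, rfl⟩ := Nat.exists_eq_add_of_le' (Finset.mem_Icc.1 hs).1
        rw [Nat.add_sub_cancel, le_div_iff₀ (by positivity)] at h
        rw [pow_succ]
        linarith
      _ = _ := by rw [Finset.mul_sum]

/-- LFBARBAR total approximate-regret accounting:
`Σ_{m=1}^M Σ_ℓ Σ_{k∈𝒦_ℓ} Δ_{k,ℓ}·n_{k,ℓ}^m ≤
  2^10·λ·M·Σ_ℓ Σ_{k∈𝒦_ℓ, Δ_{k,ℓ}>0} 1/(L_k·Δ_{k,ℓ})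
  + 2^9·L̂·(Σ_ℓ Σ_{k∈𝒦_ℓ} 1/L_k)·Σ_{s=1}^{M-1} c^s`. -/
theorem stmt_15 {A ι : Type*} [Fintype A] [Nonempty A] [Fintype ι] [DecidableEq ι]
    (Karm : A → Finset ι) (hK : ∀ ℓ, (Karm ℓ).Nonempty)
    (Lk : ι → ℕ)
    (hLk : ∀ k, Lk k = (Finset.univ.filter fun ℓ => k ∈ Karm ℓ).card)
    (hLk1 : ∀ k, 1 ≤ Lk k)
    (μ : ι → ℝ) (hμ0 : ∀ k, 0 ≤ μ k) (hμ1 : ∀ k, μ k ≤ 1)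
    (μstar : A → ℝ) (hμstar : ∀ ℓ, μstar ℓ = (Karm ℓ).sup' (hK ℓ) μ)
    (lam Lhat : ℝ) (hlam : 0 < lam) (hLhat : 1 ≤ Lhat)
    (M : ℕ)
    (Δh : ℕ → ι → A → ℝ)
    (hΔpos : ∀ m k ℓ, 0 < Δh m k ℓ)
    (n : ℕ → ι → A → ℝ)
    (hn : ∀ m ℓ, ∀ k ∈ Karm ℓ, n m k ℓ = lam * (Δh (m - 1) k ℓ)⁻¹ ^ 2 / Lk k)
    (D c : ℕ → ℝ) (hD0 : ∀ s, 0 ≤ D s)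
    (hc : ∀ s ∈ Finset.Icc 1 (M - 1), 0 ≤ c s)
    (hD : ∀ s ∈ Finset.Icc 1 (M - 1), D s ≤ 2 * Lhat * c s / (lam * 4 ^ (s - 1)))
    (ρ : ℕ → ℝ)
    (hρ : ∀ j, ρ j = ∑ s ∈ Finset.Icc 1 j, D s / (8:ℝ) ^ (j - s))
    (hgap1 : ∀ m ∈ Finset.Icc 1 M, ∀ ℓ, ∀ k ∈ Karm ℓ,
      (2:ℝ) ^ (-((m:ℤ) - 1)) ≤ Δh (m - 1) k ℓ)
    (hgap2 : ∀ m ∈ Finset.Icc 1 M, ∀ ℓ, ∀ k ∈ Karm ℓ,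
      (1/2) * (μstar ℓ - μ k) - 3 * ρ (m - 1) -
        (3/4) * (2:ℝ) ^ (-((m:ℤ) - 1)) ≤ Δh (m - 1) k ℓ) :
    ∑ m ∈ Finset.Icc 1 M, ∑ ℓ : A, ∑ k ∈ Karm ℓ, (μstar ℓ - μ k) * n m k ℓ ≤
      2 ^ 10 * lam * M *
        (∑ ℓ : A, ∑ k ∈ (Karm ℓ).filter (fun k => 0 < μstar ℓ - μ k),
          1 / (Lk k * (μstar ℓ - μ k))) +
      2 ^ 9 * Lhat * (∑ ℓ : A, ∑ k ∈ Karm ℓ, 1 / (Lk k : ℝ)) *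
        ∑ s ∈ Finset.Icc 1 (M - 1), c s := by
  have hρ0 (j : ℕ) : 0 ≤ ρ j := by
    rw [hρ]
    exact Finset.sum_nonneg fun s _ => div_nonneg (hD0 s) (by positivity)
  have hterm : ∀ m ∈ Finset.Icc 1 M, ∀ ℓ, ∀ k ∈ Karm ℓ, (μstar ℓ - μ k) * n m k ℓ ≤
      2 ^ 10 * lam * (if 0 < μstar ℓ - μ k then 1 / (Lk k * (μstar ℓ - μ k)) else 0) +
        12 * (lam * (4 ^ (m - 1) * ρ (m - 1))) * (1 / (Lk k : ℝ)) := by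
    intro m hm ℓ k hk
    have hd0 : 0 ≤ μstar ℓ - μ k := by
      rw [hμstar, sub_nonneg]
      exact Finset.le_sup' μ hk
    have hL : (0 : ℝ) < Lk k := by exact_mod_cast hLk1 k
    have hr := hρ0 (m - 1)
    rcases hd0.eq_or_lt with hd | hd
    · rw [← hd]
      simp only [lt_irrefl, if_false, zero_mul, mul_zero, zero_add]
      positivity
    · have key := gap_mul_inv_sq_le hd (by positivity) hr (hgap1 m hm ℓ k hk)
        (hgap2 m hm ℓ k hk)
      have he : (((2:ℝ) ^ (-((m:ℤ) - 1)))⁻¹) ^ 2 = 4 ^ (m - 1) := by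
        obtain ⟨t, rfl⟩ := Nat.exists_eq_add_of_le' (Finset.mem_Icc.1 hm).1
        rw [← zpow_neg, neg_neg]
        push_cast
        rw [add_sub_cancel_right, zpow_natCast, ← pow_mul, mul_comm, pow_mul]
        norm_num
      rw [he] at key
      rw [if_pos hd, hn m ℓ k hk]
      calc _ = lam / Lk k * ((μstar ℓ - μ k) * (Δh (m - 1) k ℓ)⁻¹ ^ 2) := by ring
        _ ≤ lam / Lk k * (2 ^ 10 / (μstar ℓ - μ k) + 12 * (ρ (m - 1) * 4 ^ (m - 1))) := by
          have : 49 / (μstar ℓ - μ k) ≤ 2 ^ 10 / (μstar ℓ - μ k) := by gcongr; norm_num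
          gcongr
          linarith
        _ = _ := by field_simp
  have hcorr := sum_four_pow_mul_discounted_le hlam M D c ρ hD0 hD hρ
  have hc0 : 0 ≤ ∑ s ∈ Finset.Icc 1 (M - 1), c s := Finset.sum_nonneg hc
  have hT : 0 ≤ ∑ ℓ : A, ∑ k ∈ Karm ℓ, 1 / (Lk k : ℝ) := by positivity
  simp only [Finset.sum_filter]
  calc _ ≤ ∑ m ∈ Finset.Icc 1 M, ∑ ℓ : A, ∑ k ∈ Karm ℓ, _ :=
        Finset.sum_le_sum fun m hm => Finset.sum_le_sum fun ℓ _ =>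
          Finset.sum_le_sum fun k hk => hterm m hm ℓ k hk
    _ = 2 ^ 10 * lam * M * (∑ ℓ : A, ∑ k ∈ Karm ℓ,
          if 0 < μstar ℓ - μ k then 1 / (Lk k * (μstar ℓ - μ k)) else 0) +
        12 * (lam * ∑ m ∈ Finset.Icc 1 M, 4 ^ (m - 1) * ρ (m - 1)) *
          ∑ ℓ : A, ∑ k ∈ Karm ℓ, 1 / (Lk k : ℝ) := by
      simp only [Finset.sum_add_distrib, ← Finset.mul_sum, ← Finset.sum_mul, Finset.sum_const,
        Nat.card_Icc, Nat.add_sub_cancel, nsmul_eq_mul]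
      ring
    _ ≤ _ := by
      rw [mul_right_comm (2 ^ 9 * Lhat)]
      refine add_le_add le_rfl (mul_le_mul_of_nonneg_right ?_ hT)
      have : 0 ≤ Lhat * ∑ s ∈ Finset.Icc 1 (M - 1), c s := by positivity
      linarith
end
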